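/- For every α ∈ (0, 1/1000] and all constants C# > 0, Θ > 0 there exists δ > 0 with the following property: whenever γ : [0, L] → ℝ² (L > 0) is an injective unit-speed curve of class C⁴ whose curvature satisfies κ(s) > 0, |κ'(s)| ≤ C#·(κ(s) + 2Θ)², and |κ''(s)| ≤ C#·(κ(s) + 2Θ)³ for all s ∈ [0, L]; whose inscribed radius is at least 1/((1+δ)·κ) at every point, i.e. ((1+δ)·κ(s)/2)·‖γ(s) − γ(t)‖² − ⟨γ(s) − γ(t), ν(s)⟩ ≥ 0 for all s, t; whose outer radius is at least α/κ at every point, i.e. (κ(s)/(2α))·‖γ(s) − γ(t)‖² + ⟨γ(s) − γ(t), ν(s)⟩ ≥ 0 for all s, t; and which satisfies κ(s₀) = 1 for some s₀ ∈ [0, L] — then L < 3π and |κ(s) − 1| ≤ 1/100 for all s ∈ [0, L]. -/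

import Mathlib

open Real Set

noncomputable section

/-- The second derivative of a plane curve, componentwise. -/
def d2 (γ : ℝ → ℝ × ℝ) (s : ℝ) : ℝ × ℝ :=
  (deriv (fun u => (deriv γ u).1) s, deriv (fun u => (deriv γ u).2) s)

/-- The outward unit normal `ν(s) = (γ'₂(s), −γ'₁(s))` of a unit-speed plane curve. -/
def nor (γ : ℝ → ℝ × ℝ) (s : ℝ) : ℝ × ℝ := ((deriv γ s).2, -(deriv γ s).1)

/-- The geodesic curvature `κ(s) = γ'₁(s)·γ''₂(s) − γ'₂(s)·γ''₁(s)` of a unit-speed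
plane curve. -/
def curv (γ : ℝ → ℝ × ℝ) (s : ℝ) : ℝ :=
  (deriv γ s).1 * (d2 γ s).2 - (deriv γ s).2 * (d2 γ s).1

/-- Euclidean inner product on `ℝ²`. -/
def dot (v w : ℝ × ℝ) : ℝ := v.1 * w.1 + v.2 * w.2

/-- Squared Euclidean norm on `ℝ²`. -/
def nsq (v : ℝ × ℝ) : ℝ := v.1 ^ 2 + v.2 ^ 2

/-- Mean value inequality on a compact interval. -/
lemma abs_sub_le_of_hasDerivAt {f f' : ℝ → ℝ} {a b C s t : ℝ}
    (hf : ∀ r ∈ Icc a b, HasDerivAt f (f' r) r) (hC : ∀ r ∈ Icc a b, |f' r| ≤ C)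
    (hs : s ∈ Icc a b) (ht : t ∈ Icc a b) : |f t - f s| ≤ C * |t - s| :=
  Convex.norm_image_sub_le_of_norm_hasDerivWithin_le
    (fun r hr => (hf r hr).hasDerivWithinAt) hC (convex_Icc a b) hs ht

/-- A function with nonnegative derivative on `[a, b]` is monotone there. -/
lemma monotoneOn_Icc_of_hasDerivAt {f f' : ℝ → ℝ} {a b : ℝ}
    (hf : ∀ r ∈ Icc a b, HasDerivAt f (f' r) r) (h : ∀ r ∈ Icc a b, 0 ≤ f' r) :
    MonotoneOn f (Icc a b) := by
  refine monotoneOn_of_deriv_nonneg (convex_Icc a b)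
    (fun r hr => (hf r hr).continuousAt.continuousWithinAt)
    (fun r hr => (hf r (interior_subset hr)).differentiableAt.differentiableWithinAt)
    (fun r hr => ?_)
  rw [(hf r (interior_subset hr)).deriv]
  exact h r (interior_subset hr)

/-- A convex function on `[0, 1]` with vanishing initial value and slope is nonnegative at `1`. -/
lemma nonneg_of_second_deriv_nonneg {g g' g'' : ℝ → ℝ}
    (hg : ∀ r ∈ Icc (0 : ℝ) 1, HasDerivAt g (g' r) r)
    (hg' : ∀ r ∈ Icc (0 : ℝ) 1, HasDerivAt g' (g'' r) r)
    (h : ∀ r ∈ Icc (0 : ℝ) 1, 0 ≤ g'' r) (h0 : g 0 = 0) (h1 : g' 0 = 0) : 0 ≤ g 1 := by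
  have m0 : (0 : ℝ) ∈ Icc (0 : ℝ) 1 := by simp
  have m1 : (1 : ℝ) ∈ Icc (0 : ℝ) 1 := by simp
  have hpos : ∀ r ∈ Icc (0 : ℝ) 1, 0 ≤ g' r := fun r hr =>
    h1 ▸ monotoneOn_Icc_of_hasDerivAt hg' h m0 hr hr.1
  exact h0 ▸ monotoneOn_Icc_of_hasDerivAt hg hpos m0 m1 zero_le_one

/-- Bootstrap: if the bound `1` on an initial segment improves itself to a bound `c < 1` at its
endpoint, then the bound `c` holds everywhere. -/
lemma abs_le_of_bootstrap {g : ℝ → ℝ} {c : ℝ} (hc : c < 1) (hg : Continuous g) (h0 : |g 0| < 1)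
    (h : ∀ t ∈ Icc (0 : ℝ) 1, (∀ r ∈ Icc 0 t, |g r| ≤ 1) → |g t| ≤ c) : |g 1| ≤ c := by
  suffices hs : ∀ t ∈ Icc (0 : ℝ) 1, |g t| ≤ 1 from h 1 (by simp) hs
  by_contra! hne
  obtain ⟨t, ht, hgt⟩ := hne
  set S : Set ℝ := Icc 0 1 ∩ {r | 1 ≤ |g r|} with hS
  have hcomp : IsCompact S :=
    isCompact_Icc.inter_right (isClosed_le continuous_const hg.abs)
  obtain ⟨m, hm, hmin⟩ := hcomp.exists_isLeast ⟨t, ht, hgt.le⟩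
  have hlt : ∀ r ∈ Icc 0 m, r ≠ m → |g r| < 1 := by
    intro r hr hrm
    by_contra! hge
    exact hrm (le_antisymm hr.2 (hmin ⟨⟨hr.1, hr.2.trans hm.1.2⟩, hge⟩))
  have hm1 : |g m| ≤ 1 := by
    by_contra! hgt
    obtain ⟨r, hr, hr1⟩ := intermediate_value_Icc hm.1.1 hg.abs.continuousOn ⟨h0.le, hgt.le⟩
    have hrm : r ≠ m := by
      rintro rfl
      exact hgt.ne' hr1
    exact (hlt r hr hrm).ne hr1
  have := h m hm.1 fun r hr => by
    rcases eq_or_ne r m with rfl | hrm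
    · exact hm1
    · exact (hlt r hr hrm).le
  exact absurd (this.trans_lt hc) (not_lt.mpr hm.2)

/-- The Frenet equations on `I` for a plane curve `(x, y)` with unit tangent `(u, v)` and
curvature `k`. -/
structure FrenetOn (x y u v k : ℝ → ℝ) (I : Set ℝ) : Prop where
  hx : ∀ t ∈ I, HasDerivAt x (u t) t
  hy : ∀ t ∈ I, HasDerivAt y (v t) t
  hu : ∀ t ∈ I, HasDerivAt u (-(k t * v t)) t
  hv : ∀ t ∈ I, HasDerivAt v (k t * u t) t
  unit : ∀ t ∈ I, u t ^ 2 + v t ^ 2 = 1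

namespace FrenetOn

variable {x y u v k k' k'' : ℝ → ℝ} {a b : ℝ}

lemma mono {I J : Set ℝ} (F : FrenetOn x y u v k I) (h : J ⊆ I) : FrenetOn x y u v k J :=
  ⟨fun t ht => F.hx t (h ht), fun t ht => F.hy t (h ht), fun t ht => F.hu t (h ht),
    fun t ht => F.hv t (h ht), fun t ht => F.unit t (h ht)⟩

/-- A chord is at most as long as the arc it spans. -/
lemma chord_sq_le (F : FrenetOn x y u v k (Icc a b)) {s t : ℝ} (hs : s ∈ Icc a b)
    (ht : t ∈ Icc a b) : (x s - x t) ^ 2 + (y s - y t) ^ 2 ≤ (t - s) ^ 2 := by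
  set p := x t - x s with hp
  set q := y t - y s with hq
  set ρ := √(p ^ 2 + q ^ 2) with hρ
  have hρ2 : ρ ^ 2 = p ^ 2 + q ^ 2 := Real.sq_sqrt (by positivity)
  have hρ0 : 0 ≤ ρ := Real.sqrt_nonneg _
  have hlip := abs_sub_le_of_hasDerivAt (f := fun r => p * x r + q * y r)
    (f' := fun r => p * u r + q * v r) (C := ρ)
    (fun r hr => ((F.hx r hr).const_mul p).add ((F.hy r hr).const_mul q))
    (fun r hr => by
      refine abs_le_of_sq_le_sq ?_ hρ0
      have := F.unit r hr
      nlinarith [sq_nonneg (p * v r - q * u r)]) hs ht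
  have heq : p * x t + q * y t - (p * x s + q * y s) = ρ ^ 2 := by
    rw [hρ2, hp, hq]; ring
  simp only [heq] at hlip
  rw [abs_of_nonneg (by positivity)] at hlip
  have hle : ρ ≤ |t - s| := by
    rcases hρ0.eq_or_lt with h | h
    · rw [← h]; positivity
    · nlinarith
  have := pow_le_pow_left₀ hρ0 hle 2
  rw [sq_abs, hρ2, hp, hq] at this
  nlinarith

/-- The tangent turns slowly where the curvature is at most `2`. -/
lemma one_sub_tangent_dot_le (F : FrenetOn x y u v k (Icc a b))
    (hk0 : ∀ t ∈ Icc a b, 0 < k t) (hk2 : ∀ t ∈ Icc a b, k t ≤ 2) {s t : ℝ}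
    (hs : s ∈ Icc a b) (ht : t ∈ Icc a b) :
    1 - (u t * u s + v t * v s) ≤ 4 * (t - s) ^ 2 := by
  have hbound : ∀ r ∈ Icc a b, ∀ w : ℝ, w ^ 2 ≤ 1 → |k r * w| ≤ 2 := by
    intro r hr w hw
    rw [abs_mul, abs_of_pos (hk0 r hr)]
    have : |w| ≤ 1 := abs_le_one_iff_mul_self_le_one.mpr (by nlinarith)
    nlinarith [abs_nonneg w, hk2 r hr, hk0 r hr]
  have h1 := abs_sub_le_of_hasDerivAt F.hu (C := 2)
    (fun r hr => by
      rw [abs_neg]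
      exact hbound r hr _ (by nlinarith [F.unit r hr, sq_nonneg (u r)])) hs ht
  have h2 := abs_sub_le_of_hasDerivAt F.hv (C := 2)
    (fun r hr => hbound r hr _ (by nlinarith [F.unit r hr, sq_nonneg (v r)])) hs ht
  have h1' := pow_le_pow_left₀ (abs_nonneg _) h1 2
  have h2' := pow_le_pow_left₀ (abs_nonneg _) h2 2
  rw [mul_pow, sq_abs, sq_abs] at h1' h2'
  nlinarith [F.unit s hs, F.unit t ht]

/-- Fourth-order lower bound for the height of the curve over its tangent line. -/
lemma height_lower_bound (F : FrenetOn x y u v k (Icc a b))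
    (hk0 : ∀ t ∈ Icc a b, 0 < k t) (hk2 : ∀ t ∈ Icc a b, k t ≤ 2)
    (hk : ∀ t ∈ Icc a b, HasDerivAt k (k' t) t) (hk' : ∀ t ∈ Icc a b, HasDerivAt k' (k'' t) t)
    {M : ℝ} (hM : ∀ t ∈ Icc a b, |k'' t| ≤ M) {s h : ℝ} (hs : s ∈ Icc a b)
    (hsh : s + h ∈ Icc a b) :
    k s * h ^ 2 / 2 + k' s * h ^ 3 / 6 - (M + 8) * h ^ 4 / 12 ≤
      -((x (s + h) - x s) * v s) + (y (s + h) - y s) * u s := by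
  have hM0 : 0 ≤ M := (abs_nonneg _).trans (hM s hs)
  have hmem : ∀ r ∈ Icc (0 : ℝ) 1, s + r * h ∈ Icc a b := by
    intro r hr
    have := (convex_Icc a b) hs hsh (sub_nonneg.mpr hr.2) hr.1 (by ring)
    simp only [smul_eq_mul] at this
    convert this using 1
    ring
  have hlin : ∀ r : ℝ, HasDerivAt (fun r => s + r * h) h r := fun r => by
    simpa using ((hasDerivAt_id r).mul_const h).const_add s
  have key := nonneg_of_second_deriv_nonneg
    (g := fun r => -((x (s + r * h) - x s) * v s) + (y (s + r * h) - y s) * u s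
      - (k s * h ^ 2 / 2 * r ^ 2 + k' s * h ^ 3 / 6 * r ^ 3 - (M + 8) * h ^ 4 / 12 * r ^ 4))
    (g' := fun r => -(u (s + r * h) * h * v s) + v (s + r * h) * h * u s
      - (k s * h ^ 2 * r + k' s * h ^ 3 / 2 * r ^ 2 - (M + 8) * h ^ 4 / 3 * r ^ 3))
    (g'' := fun r => h ^ 2 * (k (s + r * h) * (u (s + r * h) * u s + v (s + r * h) * v s)
      - (k s + k' s * (r * h) - (M + 8) * (r * h) ^ 2)))
    ?_ ?_ ?_ (by simp) (by simp; ring)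
  · simp only [one_mul, one_pow, mul_one] at key
    linarith
  · intro r hr
    have hX := (F.hx _ (hmem r hr)).comp r (hlin r)
    have hY := (F.hy _ (hmem r hr)).comp r (hlin r)
    have := ((((hX.sub_const (x s)).mul_const (v s)).neg.add
      ((hY.sub_const (y s)).mul_const (u s))).sub
      ((((hasDerivAt_pow 2 r).const_mul (k s * h ^ 2 / 2)).add
        ((hasDerivAt_pow 3 r).const_mul (k' s * h ^ 3 / 6))).sub
        ((hasDerivAt_pow 4 r).const_mul ((M + 8) * h ^ 4 / 12))))
    refine this.congr_deriv ?_
    push_cast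
    ring
  · intro r hr
    have hU := (F.hu _ (hmem r hr)).comp r (hlin r)
    have hV := (F.hv _ (hmem r hr)).comp r (hlin r)
    have := ((((hU.mul_const h).mul_const (v s)).neg.add
      ((hV.mul_const h).mul_const (u s))).sub
      ((((hasDerivAt_id r).const_mul (k s * h ^ 2)).add
        ((hasDerivAt_pow 2 r).const_mul (k' s * h ^ 3 / 2))).sub
        ((hasDerivAt_pow 3 r).const_mul ((M + 8) * h ^ 4 / 3))))
    refine this.congr_deriv ?_
    push_cast
    ring
  · intro r hr
    refine mul_nonneg (sq_nonneg h) ?_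
    have ht := hmem r hr
    have hturn := F.one_sub_tangent_dot_le hk0 hk2 hs ht
    have hsub : uIcc s (s + r * h) ⊆ Icc a b := uIcc_subset_Icc hs ht
    have hslope := abs_sub_le_of_hasDerivAt (f := fun τ => k τ - k' s * τ)
      (f' := fun τ => k' τ - k' s) (C := M * |r * h|)
      (a := min s (s + r * h)) (b := max s (s + r * h))
      (fun τ hτ =>
        ((hk τ (hsub hτ)).sub ((hasDerivAt_id τ).const_mul (k' s))).congr_deriv (by ring))
      (fun τ hτ => by
        refine (abs_sub_le_of_hasDerivAt hk' hM hs (hsub hτ)).trans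
          (mul_le_mul_of_nonneg_left ?_ hM0)
        simpa using abs_sub_left_of_mem_uIcc hτ)
      (s := s) (t := s + r * h) left_mem_uIcc right_mem_uIcc
    have hq : M * |r * h| * |s + r * h - s| = M * (r * h) ^ 2 := by
      rw [add_sub_cancel_left, mul_assoc, ← sq, sq_abs]
    rw [hq] at hslope
    have hslope := (abs_le.mp hslope).1
    rw [add_sub_cancel_left] at hturn
    nlinarith [hk0 _ ht, hk2 _ ht, mul_le_mul_of_nonneg_left hturn (hk0 _ ht).le,
      mul_le_mul_of_nonneg_right (hk2 _ ht) (sq_nonneg (r * h))]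

/-- The inscribed radius condition bounds the odd part of the height over the tangent line. -/
lemma deriv_curvature_mul_le (F : FrenetOn x y u v k (Icc a b))
    (hk0 : ∀ t ∈ Icc a b, 0 < k t) (hk2 : ∀ t ∈ Icc a b, k t ≤ 2)
    (hk : ∀ t ∈ Icc a b, HasDerivAt k (k' t) t) (hk' : ∀ t ∈ Icc a b, HasDerivAt k' (k'' t) t)
    {M δ : ℝ} (hδ : 0 ≤ δ) (hM : ∀ t ∈ Icc a b, |k'' t| ≤ M)
    (hin : ∀ s ∈ Icc a b, ∀ t ∈ Icc a b, (x s - x t) * v s - (y s - y t) * u s ≤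
      (1 + δ) * k s / 2 * ((x s - x t) ^ 2 + (y s - y t) ^ 2))
    {s h : ℝ} (hs : s ∈ Icc a b) (hsh : s + h ∈ Icc a b) :
    k' s * h ^ 3 ≤ 6 * δ * h ^ 2 + (M + 8) * h ^ 4 := by
  have h1 := F.height_lower_bound hk0 hk2 hk hk' hM hs hsh
  have h2 := hin s hs _ hsh
  have h3 := F.chord_sq_le hs hsh
  rw [add_sub_cancel_left] at h3
  have hM0 : 0 ≤ M := (abs_nonneg _).trans (hM s hs)
  have h4 : (1 + δ) * k s / 2 * ((x s - x (s + h)) ^ 2 + (y s - y (s + h)) ^ 2) ≤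
      (1 + δ) * k s / 2 * h ^ 2 :=
    mul_le_mul_of_nonneg_left h3 (by have := hk0 s hs; positivity)
  have h5 : δ * h ^ 2 * k s ≤ δ * h ^ 2 * 2 :=
    mul_le_mul_of_nonneg_left (hk2 s hs) (by positivity)
  have h6 : 0 ≤ (M + 8) * h ^ 4 := by positivity
  nlinarith

/-- Where the curvature is at most `2`, an almost sharp inscribed radius forces it to be almost
constant. -/
lemma abs_curvature_sub_le (F : FrenetOn x y u v k (Icc a b)) (hab : a ≤ b)
    (hk0 : ∀ t ∈ Icc a b, 0 < k t) (hk2 : ∀ t ∈ Icc a b, k t ≤ 2)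
    (hk : ∀ t ∈ Icc a b, HasDerivAt k (k' t) t) (hk' : ∀ t ∈ Icc a b, HasDerivAt k' (k'' t) t)
    {M₁ M η : ℝ} (hη : 0 < η) (hM₁ : ∀ t ∈ Icc a b, |k' t| ≤ M₁)
    (hM : ∀ t ∈ Icc a b, |k'' t| ≤ M)
    (hin : ∀ s ∈ Icc a b, ∀ t ∈ Icc a b, (x s - x t) * v s - (y s - y t) * u s ≤
      (1 + η ^ 2) * k s / 2 * ((x s - x t) ^ 2 + (y s - y t) ^ 2)) :
    |k b - k a| ≤ (2 * M₁ + (2 * M + 14) * (b - a)) * η := by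
  have ha : a ∈ Icc a b := left_mem_Icc.mpr hab
  have hb : b ∈ Icc a b := right_mem_Icc.mpr hab
  have hM₁0 : 0 ≤ M₁ := (abs_nonneg _).trans (hM₁ a ha)
  have hM0 : 0 ≤ M := (abs_nonneg _).trans (hM a ha)
  have hba : 0 ≤ b - a := sub_nonneg.mpr hab
  rcases lt_or_ge (b - a) (2 * η) with hshort | hlong
  · have h1 := abs_sub_le_of_hasDerivAt hk hM₁ ha hb
    rw [abs_of_nonneg hba] at h1
    have h2 : M₁ * (b - a) ≤ M₁ * (2 * η) := mul_le_mul_of_nonneg_left hshort.le hM₁0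
    have h3 : 0 ≤ (2 * M + 14) * (b - a) * η := by positivity
    linarith
  · have hcube : 0 < η ^ 3 := by positivity
    have hup : ∀ s ∈ Icc a b, s + η ∈ Icc a b → k' s ≤ (M + 14) * η := by
      intro s hs hsh
      have := F.deriv_curvature_mul_le hk0 hk2 hk hk' (sq_nonneg η) hM hin hs hsh
      refine le_of_mul_le_mul_right ?_ hcube
      linarith
    have hlow : ∀ s ∈ Icc a b, s + -η ∈ Icc a b → -k' s ≤ (M + 14) * η := by
      intro s hs hsh
      have := F.deriv_curvature_mul_le hk0 hk2 hk hk' (sq_nonneg η) hM hin hs hsh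
      refine le_of_mul_le_mul_right ?_ hcube
      linarith
    have hderiv : ∀ s ∈ Icc a b, |k' s| ≤ (2 * M + 14) * η := by
      intro s hs
      have hMη : 0 ≤ M * η := by positivity
      refine abs_le'.mpr ⟨?_, ?_⟩
      · by_cases hsη : s + η ≤ b
        · linarith [hup s hs ⟨by linarith [hs.1], hsη⟩]
        · have hmem : s - η ∈ Icc a b := ⟨by linarith, by linarith [hs.2]⟩
          have h1 := hup (s - η) hmem (by simpa using hs)
          have h2 := (abs_le.mp (abs_sub_le_of_hasDerivAt hk' hM hmem hs)).2
          rw [sub_sub_cancel, abs_of_pos hη] at h2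
          linarith
      · by_cases hsη : a ≤ s + -η
        · linarith [hlow s hs ⟨hsη, by linarith [hs.2]⟩]
        · have hmem : s + η ∈ Icc a b := ⟨by linarith [hs.1], by linarith⟩
          have h1 := hlow (s + η) hmem (by simpa using hs)
          have h2 := (abs_le.mp (abs_sub_le_of_hasDerivAt hk' hM hs hmem)).2
          rw [add_sub_cancel_left, abs_of_pos hη] at h2
          linarith
    have h1 := abs_sub_le_of_hasDerivAt hk hderiv ha hb
    rw [abs_of_nonneg hba] at h1
    have h2 : 0 ≤ M₁ * η := by positivity
    linarith

/-- Along an arc of length `3π` on which the curvature is almost `1`, the curve returns close to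
its starting point and meets the normal line there. -/
lemma exists_return (F : FrenetOn x y u v k (Icc a b)) (hkc : Continuous k)
    (hb : b = a + 3 * π) {ε : ℝ} (hε : ε ≤ 1 / 100) (hkε : ∀ t ∈ Icc a b, |k t - 1| ≤ ε) :
    ∃ t ∈ Icc a b, a < t ∧ (x t - x a) * u a + (y t - y a) * v a = 0 ∧
      |-((x t - x a) * v a) + (y t - y a) * u a| ≤ 20 * ε := by
  have hπ := Real.pi_pos
  have hπ2 := Real.pi_lt_d2
  have hπ3 := Real.pi_gt_three
  have hab : a ≤ b := by linarith
  have ha : a ∈ Icc a b := left_mem_Icc.mpr hab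
  have hε0 : 0 ≤ ε := (abs_nonneg _).trans (hkε a ha)
  set θ : ℝ → ℝ := fun t => ∫ r in a..t, k r with hθ
  have hθ' : ∀ t, HasDerivAt θ (k t) t := fun t =>
    (hkc.integral_hasStrictDerivAt a t).hasDerivAt
  have hθa : θ a = 0 := by simp [hθ]
  have hθc : Continuous θ := continuous_iff_continuousAt.mpr fun t => (hθ' t).continuousAt
  have hθmono : MonotoneOn θ (Icc a b) := monotoneOn_Icc_of_hasDerivAt (fun t _ => hθ' t)
    fun t ht => by linarith [(abs_le.mp (hkε t ht)).1]
  set c : ℝ → ℝ := fun t => u t * u a + v t * v a with hc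
  set d : ℝ → ℝ := fun t => -(u t * v a) + v t * u a with hd
  set X : ℝ → ℝ := fun t => (x t - x a) * u a + (y t - y a) * v a with hX
  set Y : ℝ → ℝ := fun t => -((x t - x a) * v a) + (y t - y a) * u a with hY
  have hua := F.unit a ha
  have hc' : ∀ t ∈ Icc a b, HasDerivAt c (-(k t * d t)) t := fun t ht =>
    (((F.hu t ht).mul_const (u a)).add ((F.hv t ht).mul_const (v a))).congr_deriv (by
      simp only [hd]; ring)
  have hd' : ∀ t ∈ Icc a b, HasDerivAt d (k t * c t) t := fun t ht =>
    (((F.hu t ht).mul_const (v a)).neg.add ((F.hv t ht).mul_const (u a))).congr_deriv (by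
      simp only [hc]; ring)
  have hX' : ∀ t ∈ Icc a b, HasDerivAt X (c t) t := fun t ht =>
    (((F.hx t ht).sub_const (x a)).mul_const (u a)).add
      (((F.hy t ht).sub_const (y a)).mul_const (v a))
  have hY' : ∀ t ∈ Icc a b, HasDerivAt Y (d t) t := fun t ht =>
    (((F.hx t ht).sub_const (x a)).mul_const (v a)).neg.add
      (((F.hy t ht).sub_const (y a)).mul_const (u a))
  have hca : c a = 1 := by simp only [hc]; linarith
  have hda : d a = 0 := by simp only [hd]; ring
  have hXa : X a = 0 := by simp [hX]
  have hYa : Y a = 0 := by simp [hY]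
  have hcd : ∀ t ∈ Icc a b, c t ^ 2 + d t ^ 2 = 1 := fun t ht => by
    have : c t ^ 2 + d t ^ 2 = (u t ^ 2 + v t ^ 2) * (u a ^ 2 + v a ^ 2) := by
      simp only [hc, hd]; ring
    rw [this, F.unit t ht, hua, one_mul]
  have hangle : ∀ t ∈ Icc a b, c t = cos (θ t) ∧ d t = sin (θ t) := by
    intro t ht
    have h := abs_sub_le_of_hasDerivAt
      (f := fun t => (c t - cos (θ t)) ^ 2 + (d t - sin (θ t)) ^ 2) (f' := fun _ => 0) (C := 0)
      (fun r hr => ((((hc' r hr).sub (hθ' r).cos).pow 2).add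
        (((hd' r hr).sub (hθ' r).sin).pow 2)).congr_deriv (by
          simp only [Pi.sub_apply]; push_cast; ring)) (by simp) ha ht
    simp only [hca, hda, hθa, cos_zero, sin_zero, sub_self, zero_mul] at h
    have h0 : (c t - cos (θ t)) ^ 2 + (d t - sin (θ t)) ^ 2 = 0 := by
      simpa using abs_nonpos_iff.mp h
    constructor <;> nlinarith [sq_nonneg (c t - cos (θ t)), sq_nonneg (d t - sin (θ t))]
  have hclose : ∀ {w : ℝ → ℝ}, (∀ r ∈ Icc a b, |w r| ≤ 1) → ∀ r ∈ Icc a b,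
      |(k r - 1) * w r| ≤ ε := fun hw r hr => by
    rw [abs_mul]
    nlinarith [hkε r hr, hw r hr, abs_nonneg (k r - 1)]
  have hlen : ∀ t ∈ Icc a b, ε * |t - a| ≤ 10 * ε := fun t ht => by
    rw [abs_of_nonneg (sub_nonneg.mpr ht.1)]
    nlinarith [ht.2]
  have hc1 : ∀ r ∈ Icc a b, |c r| ≤ 1 := fun r hr =>
    abs_le_one_iff_mul_self_le_one.mpr (by nlinarith [hcd r hr, sq_nonneg (d r)])
  have hd1 : ∀ r ∈ Icc a b, |d r| ≤ 1 := fun r hr =>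
    abs_le_one_iff_mul_self_le_one.mpr (by nlinarith [hcd r hr, sq_nonneg (c r)])
  have hdX : ∀ t ∈ Icc a b, |d t - X t| ≤ 10 * ε := fun t ht => by
    have := abs_sub_le_of_hasDerivAt (f := fun t => d t - X t) (C := ε)
      (fun r hr => ((hd' r hr).sub (hX' r hr)).congr_deriv
        (show _ = (k r - 1) * c r by ring)) (hclose hc1) ha ht
    simp only [hda, hXa, sub_zero] at this
    exact this.trans (hlen t ht)
  have hcY : ∀ t ∈ Icc a b, |1 - c t - Y t| ≤ 10 * ε := fun t ht => by
    have := abs_sub_le_of_hasDerivAt (f := fun t => 1 - c t - Y t) (C := ε)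
      (fun r hr => (((hc' r hr).const_sub 1).sub (hY' r hr)).congr_deriv
        (show _ = (k r - 1) * d r by ring)) (hclose hd1) ha ht
    simp only [hca, hYa, sub_self, sub_zero] at this
    exact this.trans (hlen t ht)
  have hθb : 5 * π / 2 ≤ θ b := by
    have := abs_sub_le_of_hasDerivAt (f := fun t => θ t - t) (C := ε)
      (fun r _ => (hθ' r).sub (hasDerivAt_id r)) hkε ha (right_mem_Icc.mpr hab)
    have h2 := hlen b (right_mem_Icc.mpr hab)
    rw [hθa] at this
    have := (abs_le.mp (this.trans h2)).1
    linarith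
  obtain ⟨t₁, ht₁, hθ₁⟩ : 3 * π / 2 ∈ θ '' Icc a b :=
    intermediate_value_Icc hab hθc.continuousOn ⟨by linarith, by linarith⟩
  obtain ⟨t₂, ht₂, hθ₂⟩ : 5 * π / 2 ∈ θ '' Icc t₁ b :=
    intermediate_value_Icc ht₁.2 hθc.continuousOn ⟨by linarith, hθb⟩
  have hsub : Icc t₁ t₂ ⊆ Icc a b := Icc_subset_Icc ht₁.1 ht₂.2
  have ht₂' : t₂ ∈ Icc a b := hsub (right_mem_Icc.mpr ht₂.1)
  have hX₁ : X t₁ ≤ 0 := by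
    have h1 := (abs_le.mp (hdX t₁ ht₁)).1
    have : sin (3 * π / 2) = -1 := by
      rw [show 3 * π / 2 = π / 2 + π by ring, sin_add_pi, sin_pi_div_two]
    rw [(hangle t₁ ht₁).2, hθ₁, this] at h1
    linarith
  have hX₂ : 0 ≤ X t₂ := by
    have h1 := (abs_le.mp (hdX t₂ ht₂')).2
    have : sin (5 * π / 2) = 1 := by
      rw [show 5 * π / 2 = π / 2 + 2 * π by ring, sin_add_two_pi, sin_pi_div_two]
    rw [(hangle t₂ ht₂').2, hθ₂, this] at h1
    linarith
  obtain ⟨t, ht, hXt⟩ : (0 : ℝ) ∈ X '' Icc t₁ t₂ :=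
    intermediate_value_Icc ht₂.1
      (fun r hr => (hX' r (hsub hr)).continuousAt.continuousWithinAt) ⟨hX₁, hX₂⟩
  have htab := hsub ht
  have hθt₁ : 3 * π / 2 ≤ θ t := hθ₁ ▸ hθmono ht₁ htab ht.1
  have hθt₂ : θ t ≤ 5 * π / 2 := hθ₂ ▸ hθmono htab ht₂' ht.2
  refine ⟨t, htab, lt_of_le_of_ne htab.1 ?_, hXt, ?_⟩
  · rintro rfl
    linarith
  · have hct : 0 ≤ c t := by
      rw [(hangle t htab).1, ← cos_sub_two_pi]
      exact cos_nonneg_of_neg_pi_div_two_le_of_le (by linarith) (by linarith)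
    have hdt := hdX t htab
    rw [hXt, sub_zero] at hdt
    have hd2 : d t ^ 2 ≤ (10 * ε) ^ 2 := sq_le_sq' (abs_le.mp hdt).1 (abs_le.mp hdt).2
    have hct1 := (abs_le.mp (hc1 t htab)).2
    have h1c : 1 - c t ≤ ε := by nlinarith [hcd t htab]
    have h := abs_le.mp (hcY t htab)
    exact abs_le.mpr ⟨by linarith [h.2], by linarith [h.1]⟩

end FrenetOn

/-- A `C⁴` unit-speed curve satisfies the Frenet equations with curvature `curv γ`, also at the
endpoints of the interval. -/
lemma frenetOn_of_nsq_deriv {γ : ℝ → ℝ × ℝ} {L : ℝ} (hL : 0 < L) (hγ : ContDiff ℝ 4 γ)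
    (hunit : ∀ s ∈ Icc 0 L, nsq (deriv γ s) = 1) :
    FrenetOn (fun t => (γ t).1) (fun t => (γ t).2) (fun t => (deriv γ t).1)
      (fun t => (deriv γ t).2) (curv γ) (Icc 0 L) := by
  have hγd : ∀ t, HasDerivAt γ (deriv γ t) t := fun t =>
    (hγ.differentiable (by norm_num) t).hasDerivAt
  have hγ' : ContDiff ℝ 3 (deriv γ) := (contDiff_succ_iff_deriv.mp hγ).2.2
  have hγd' : Differentiable ℝ (deriv γ) := hγ'.differentiable (by norm_num)
  have hu : ∀ t, HasDerivAt (fun t => (deriv γ t).1) (d2 γ t).1 t := fun t =>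
    (hγd' t).fst.hasDerivAt
  have hv : ∀ t, HasDerivAt (fun t => (deriv γ t).2) (d2 γ t).2 t := fun t =>
    (hγd' t).snd.hasDerivAt
  have hperp : ∀ t ∈ Icc 0 L,
      (deriv γ t).1 * (d2 γ t).1 + (deriv γ t).2 * (d2 γ t).2 = 0 := by
    intro t ht
    have h1 : HasDerivWithinAt (fun t => nsq (deriv γ t))
        (2 * (deriv γ t).1 * (d2 γ t).1 + 2 * (deriv γ t).2 * (d2 γ t).2) (Icc 0 L) t :=
      ((((hu t).pow 2).add ((hv t).pow 2)).congr_deriv (by push_cast; ring)).hasDerivWithinAt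
    have h2 : HasDerivWithinAt (fun t => nsq (deriv γ t)) 0 (Icc 0 L) t :=
      (hasDerivWithinAt_const t _ (1 : ℝ)).congr hunit (hunit t ht)
    have := (uniqueDiffOn_Icc hL t ht).eq_deriv _ h1 h2
    linarith
  refine ⟨fun t _ => (hγd t).fst, fun t _ => (hγd t).snd, fun t ht => (hu t).congr_deriv ?_,
    fun t ht => (hv t).congr_deriv ?_, hunit⟩
  · have h1 := hunit t ht
    have h2 := hperp t ht
    simp only [nsq] at h1
    simp only [curv]
    linear_combination (-(d2 γ t).1) * h1 + (deriv γ t).1 * h2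
  · have h1 := hunit t ht
    have h2 := hperp t ht
    simp only [nsq] at h1
    simp only [curv]
    linear_combination (-(d2 γ t).2) * h1 + (deriv γ t).2 * h2

lemma contDiff_curv {γ : ℝ → ℝ × ℝ} (hγ : ContDiff ℝ 4 γ) : ContDiff ℝ 2 (curv γ) := by
  have hγ' : ContDiff ℝ 3 (deriv γ) := (contDiff_succ_iff_deriv.mp hγ).2.2
  have h1 : ContDiff ℝ 2 (fun t => (d2 γ t).1) :=
    ((contDiff_succ_iff_deriv (n := 2)).mp hγ'.fst).2.2
  have h2 : ContDiff ℝ 2 (fun t => (d2 γ t).2) :=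
    ((contDiff_succ_iff_deriv (n := 2)).mp hγ'.snd).2.2
  have hle : (2 : WithTop ℕ∞) ≤ 3 := by norm_num
  exact ((hγ'.of_le hle).fst.mul h2).sub ((hγ'.of_le hle).snd.mul h1)

/-- A curve with curvature close to `1` near `s₀` that satisfies both radius conditions cannot wind
around one and a half times. -/
lemma length_lt_three_pi {γ : ℝ → ℝ × ℝ} {L α δ s₀ : ℝ}
    (F : FrenetOn (fun t => (γ t).1) (fun t => (γ t).2) (fun t => (deriv γ t).1)
      (fun t => (deriv γ t).2) (curv γ) (Icc 0 L))
    (hcont : Continuous (curv γ)) (hinj : InjOn γ (Icc 0 L)) (hα : 0 < α) (hα1 : α ≤ 1)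
    (hδ1 : δ ≤ 1)
    (hin : ∀ s ∈ Icc 0 L, ∀ t ∈ Icc 0 L,
      (1 + δ) * curv γ s / 2 * nsq (γ s - γ t) - dot (γ s - γ t) (nor γ s) ≥ 0)
    (hout : ∀ s ∈ Icc 0 L, ∀ t ∈ Icc 0 L,
      curv γ s / (2 * α) * nsq (γ s - γ t) + dot (γ s - γ t) (nor γ s) ≥ 0)
    (hs₀ : s₀ ∈ Icc 0 L)
    (hnear : ∀ s ∈ Icc 0 L, |s - s₀| ≤ 3 * π → |curv γ s - 1| ≤ α / 100) : L < 3 * π := by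
  by_contra! hL3
  have hπ := Real.pi_pos
  obtain ⟨a, ha0, haL, has, hsa⟩ :
      ∃ a, 0 ≤ a ∧ a + 3 * π ≤ L ∧ a ≤ s₀ ∧ s₀ ≤ a + 3 * π := by
    rcases le_total s₀ (L - 3 * π) with h | h
    · exact ⟨s₀, hs₀.1, by linarith, le_rfl, by linarith⟩
    · exact ⟨L - 3 * π, by linarith, by linarith, h, by linarith [hs₀.2]⟩
  have hsub : Icc a (a + 3 * π) ⊆ Icc 0 L := Icc_subset_Icc ha0 haL
  have ha : a ∈ Icc 0 L := hsub (left_mem_Icc.mpr (by linarith))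
  have hkε : ∀ t ∈ Icc a (a + 3 * π), |curv γ t - 1| ≤ α / 100 := fun t ht =>
    hnear t (hsub ht) (abs_le.mpr ⟨by linarith [ht.1], by linarith [ht.2]⟩)
  obtain ⟨t, ht, hat, hX, hY⟩ :=
    (F.mono hsub).exists_return hcont rfl (by linarith) hkε
  have h1 := hin a ha t (hsub ht)
  have h2 := hout a ha t (hsub ht)
  have hua := F.unit a ha
  have hka := abs_le.mp (hkε a (left_mem_Icc.mpr (by linarith)))
  have hne : γ a ≠ γ t := fun h => hat.ne (hinj ha (hsub ht) h)
  simp only [nsq, dot, nor, Prod.fst_sub, Prod.snd_sub] at h1 h2 hua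
  set p := (γ t).1 - (γ a).1 with hp
  set q := (γ t).2 - (γ a).2 with hq
  set u := (deriv γ a).1
  set v := (deriv γ a).2
  set Y := -(p * v) + q * u with hYdef
  have hnsq : ((γ a).1 - (γ t).1) ^ 2 + ((γ a).2 - (γ t).2) ^ 2 = Y ^ 2 := by
    have h3 : ((γ a).1 - (γ t).1) ^ 2 + ((γ a).2 - (γ t).2) ^ 2 = p ^ 2 + q ^ 2 := by
      rw [hp, hq]; ring
    have h4 : Y ^ 2 + (p * u + q * v) ^ 2 = (p ^ 2 + q ^ 2) * (u ^ 2 + v ^ 2) := by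
      rw [hYdef]; ring
    rw [h3, ← mul_one (p ^ 2 + q ^ 2), ← hua, ← h4, hX]; ring
  have hdot : ((γ a).1 - (γ t).1) * v + ((γ a).2 - (γ t).2) * -u = Y := by
    rw [hYdef, hp, hq]; ring
  rw [hnsq, hdot] at h1 h2
  have hYb := abs_le.mp hY
  rcases lt_trichotomy Y 0 with hneg | hzero | hposY
  · have h5 : curv γ a / (2 * α) ≤ 1 / α := by
      rw [div_le_div_iff₀ (by positivity) hα]
      have := mul_le_mul_of_nonneg_right (show curv γ a ≤ 2 by linarith) hα.le
      linarith
    have h6 : 0 ≤ 1 / α * Y ^ 2 + Y :=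
      h2.le.trans (by have := mul_le_mul_of_nonneg_right h5 (sq_nonneg Y); linarith)
    have h7 : 0 ≤ Y ^ 2 + α * Y := by
      have := mul_nonneg hα.le h6
      have e : α * (1 / α * Y ^ 2 + Y) = Y ^ 2 + α * Y := by field_simp
      rwa [e] at this
    nlinarith [mul_neg_of_neg_of_pos hneg (show 0 < Y + α by linarith)]
  · apply hne
    rw [hzero] at hnsq
    rw [zero_pow two_ne_zero, add_eq_zero_iff_of_nonneg (sq_nonneg _) (sq_nonneg _),
      sq_eq_zero_iff, sq_eq_zero_iff, sub_eq_zero, sub_eq_zero] at hnsq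
    exact Prod.ext hnsq.1 hnsq.2
  · have h5 : (1 + δ) * curv γ a / 2 ≤ 2 := by
      have := mul_le_mul_of_nonneg_right hδ1 (show 0 ≤ curv γ a by linarith)
      linarith
    have h6 := mul_le_mul_of_nonneg_right h5 (sq_nonneg Y)
    nlinarith [mul_pos hposY (show 0 < 1 - 2 * Y by linarith)]

/-- For every `α ∈ (0, 1/1000]`, `C# > 0`, `Θ > 0` there exists
`δ > 0` such that every injective unit-speed `C⁴` curve on `[0, L]` with positive
curvature, derivative bounds `|κ'| ≤ C#(κ + 2Θ)²` and `|κ''| ≤ C#(κ + 2Θ)³`,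
inscribed radius at least `1/((1+δ)κ)`, outer radius at least `α/κ`, and `κ = 1`
somewhere, satisfies `L < 3π` and `|κ − 1| ≤ 1/100` everywhere. -/
theorem stmt5 :
    ∀ α ∈ Set.Ioc (0 : ℝ) (1 / 1000), ∀ Csharp > (0 : ℝ), ∀ Θ > (0 : ℝ),
    ∃ δ > (0 : ℝ),
      ∀ (L : ℝ) (γ : ℝ → ℝ × ℝ) (s₀ : ℝ), 0 < L →
        Set.InjOn γ (Icc 0 L) → ContDiff ℝ 4 γ →
        (∀ s ∈ Icc 0 L, nsq (deriv γ s) = 1) →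
        (∀ s ∈ Icc 0 L, 0 < curv γ s) →
        (∀ s ∈ Icc 0 L, |deriv (curv γ) s| ≤ Csharp * (curv γ s + 2 * Θ) ^ 2) →
        (∀ s ∈ Icc 0 L, |deriv (deriv (curv γ)) s| ≤ Csharp * (curv γ s + 2 * Θ) ^ 3) →
        (∀ s ∈ Icc 0 L, ∀ t ∈ Icc 0 L,
          (1 + δ) * curv γ s / 2 * nsq (γ s - γ t) - dot (γ s - γ t) (nor γ s) ≥ 0) →
        (∀ s ∈ Icc 0 L, ∀ t ∈ Icc 0 L,
          curv γ s / (2 * α) * nsq (γ s - γ t) + dot (γ s - γ t) (nor γ s) ≥ 0) →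
        s₀ ∈ Icc 0 L → curv γ s₀ = 1 →
        L < 3 * π ∧ ∀ s ∈ Icc 0 L, |curv γ s - 1| ≤ 1 / 100 := by
  rintro α ⟨hα, hα1⟩ C hC Θ hΘ
  set ε : ℝ := α / 100 with hε
  have hε0 : 0 < ε := by positivity
  set M₁ : ℝ := C * (2 + 2 * Θ) ^ 2 with hM₁
  set M : ℝ := C * (2 + 2 * Θ) ^ 3 with hM
  set S : ℝ := 2 * M₁ + (2 * M + 14) * 10 with hS
  have hS1 : 1 ≤ S := by
    have : 0 < M₁ := by positivity
    have : 0 < M := by positivity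
    linarith
  set η : ℝ := ε / S with hη
  have hη0 : 0 < η := by positivity
  have hSη : S * η = ε := mul_div_cancel₀ _ (by positivity)
  have hη1 : η ≤ 1 := by nlinarith
  refine ⟨η ^ 2, by positivity, ?_⟩
  intro L γ s₀ hL hinj hγ hunit hpos hd1 hd2 hin hout hs₀ hκ
  have F := frenetOn_of_nsq_deriv hL hγ hunit
  have hcurv := contDiff_curv hγ
  have hcont : Continuous (curv γ) := hcurv.continuous
  have hk : ∀ t, HasDerivAt (curv γ) (deriv (curv γ) t) t := fun t =>
    (hcurv.differentiable (by norm_num) t).hasDerivAt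
  have hk' : ∀ t, HasDerivAt (deriv (curv γ)) (deriv (deriv (curv γ)) t) t := fun t =>
    ((((contDiff_succ_iff_deriv (n := 1)).mp hcurv).2.2).differentiable (by norm_num) t).hasDerivAt
  have hπ2 := Real.pi_lt_d2
  have hosc : ∀ a ∈ Icc 0 L, ∀ b ∈ Icc 0 L, a ≤ b → b - a ≤ 3 * π →
      (∀ r ∈ Icc a b, |curv γ r - 1| ≤ 1) → |curv γ b - curv γ a| ≤ ε := by
    intro a ha b hb hab hlen hnear
    have hsub : Icc a b ⊆ Icc 0 L := Icc_subset_Icc ha.1 hb.2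
    have hk2 : ∀ t ∈ Icc a b, curv γ t ≤ 2 := fun t ht => by
      linarith [(abs_le.mp (hnear t ht)).2]
    have h := (F.mono hsub).abs_curvature_sub_le hab (fun t ht => hpos t (hsub ht)) hk2
      (fun t _ => hk t) (fun t _ => hk' t) hη0 (M₁ := M₁) (M := M)
      (fun t ht => (hd1 t (hsub ht)).trans (by
        have := hpos t (hsub ht)
        have := hk2 t ht
        rw [hM₁]; gcongr))
      (fun t ht => (hd2 t (hsub ht)).trans (by
        have := hpos t (hsub ht)
        have := hk2 t ht
        rw [hM]; gcongr))
      (fun s hs t ht => by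
        have := hin s (hsub hs) t (hsub ht)
        simp only [nsq, dot, nor, Prod.fst_sub, Prod.snd_sub] at this
        linarith)
    refine h.trans (le_trans ?_ hSη.le)
    have hM0 : 0 < M := by positivity
    refine mul_le_mul_of_nonneg_right ?_ hη0.le
    nlinarith
  have hnear : ∀ s ∈ Icc 0 L, |s - s₀| ≤ 3 * π → |curv γ s - 1| ≤ ε := by
    intro s hs hlen
    have h := abs_le_of_bootstrap (g := fun r => curv γ (s₀ + r * (s - s₀)) - 1) (c := ε)
      (by linarith) (by fun_prop) (by simp [hκ]) ?_
    · simpa using h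
    intro t ht hle
    set q := s₀ + t * (s - s₀) with hq
    have hqmem : q ∈ Icc 0 L := by
      have := (convex_Icc 0 L) hs₀ hs (sub_nonneg.mpr ht.2) ht.1 (by ring)
      simp only [smul_eq_mul] at this
      convert this using 1
      rw [hq]; ring
    have hqlen : |q - s₀| ≤ 3 * π := by
      rw [hq, add_sub_cancel_left, abs_mul, abs_of_nonneg ht.1]
      nlinarith [ht.2, abs_nonneg (s - s₀)]
    have hseg : ∀ r ∈ uIcc s₀ q, |curv γ r - 1| ≤ 1 := by
      intro r hr
      rw [← segment_eq_uIcc, segment_eq_image'] at hr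
      obtain ⟨τ, hτ, rfl⟩ := hr
      have := hle (τ * t) ⟨mul_nonneg hτ.1 ht.1, by nlinarith [hτ.2, ht.1]⟩
      convert this using 4
      simp only [smul_eq_mul]; ring
    rcases le_total s₀ q with h | h
    · rw [uIcc_of_le h] at hseg
      rw [abs_of_nonneg (sub_nonneg.mpr h)] at hqlen
      have := hosc s₀ hs₀ q hqmem h hqlen hseg
      rwa [hκ] at this
    · rw [uIcc_of_ge h] at hseg
      rw [abs_sub_comm, abs_of_nonneg (sub_nonneg.mpr h)] at hqlen
      have := hosc q hqmem s₀ hs₀ h hqlen hseg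
      rwa [hκ, abs_sub_comm] at this
  have hLlt : L < 3 * π := length_lt_three_pi F hcont hinj hα (by linarith) (by nlinarith)
    hin hout hs₀ hnear
  refine ⟨hLlt, fun s hs => (hnear s hs (abs_le.mpr ⟨?_, ?_⟩)).trans (by linarith)⟩
  · linarith [hs.1, hs₀.2]
  · linarith [hs.2, hs₀.1]

end
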